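/- Sensitivity of the pessimistic utility value to the Lagrange multiplier. Let κ > 0, C_λ ≥ 0, and suppose each map P̂_h is ℝ-linear and satisfies |(P̂_h V)(s,a)| ≤ M·max_{s'} |V(s')| for all V: S → ℝ, (s,a) ∈ S×A, and some M ≥ 0. Write H_κ = H·(1+κ·ln|A|), X = M·(1 + 8·(1+C_λ)·(H_κ + B_†·H + H)/κ), and Y = 8·(H_κ + B_†·H + H)/κ. Then for all λ ≥ 0 and ε ≥ 0 with λ + ε ≤ C_λ: | V̲^{π^λ,u}_1(s₁) − V̲^{π^{λ+ε},u}_1(s₁) | ≤ (Σ_{j=0}^{H} X^j)·Y·H·ε, where π^λ and π^{λ+ε} are the composite softmax policies with parameters λ and λ+ε. -/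

import Mathlib

/-- Entropy-regularized value function of policy `pol` for reward `g` (backward recursion on
the number of remaining steps). -/
noncomputable def Vaux {S A : Type*} [Fintype S] [Fintype A]
    (P : ℕ → S → A → S → ℝ) (pol : ℕ → S → A → ℝ) (g : ℕ → S → A → ℝ) (κ : ℝ) :
    ℕ → ℕ → S → ℝ
  | 0, _, _ => 0
  | n + 1, h, s => ∑ a, pol h s a *
      ((g h s a + ∑ s', P h s a s' * Vaux P pol g κ n (h + 1) s')
        - κ * Real.log (pol h s a))

/-- `Vval H P pol g κ h s = V^{pol,g}_{P,h}[κ](s)` for a horizon-`H` MDP. -/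
noncomputable def Vval {S A : Type*} [Fintype S] [Fintype A] (H : ℕ)
    (P : ℕ → S → A → S → ℝ) (pol : ℕ → S → A → ℝ) (g : ℕ → S → A → ℝ) (κ : ℝ)
    (h : ℕ) (s : S) : ℝ :=
  Vaux P pol g κ (H + 1 - h) h s

/-- Joint backward recursion (on the number of remaining steps) computing, for the composite
softmax policy `π^λ_h(·|s) = softmax((Q̄^{π^λ,†}_h(s,·) + Q̄^{π^λ,r}_h[κ](s,·) + λ·Q̲^{π^λ,u}_h(s,·))/κ)`
built from the clipped value functions, the triple `(V̄^{π^λ,†}_h(s), V̄^{π^λ,r}_h[κ](s), V̲^{π^λ,u}_h(s))`. -/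
noncomputable def ClipTripleAux {S A : Type*} [Fintype S] [Fintype A]
    (Phat : ℕ → (S → ℝ) → S → A → ℝ) (r u β : ℕ → S → A → ℝ)
    (Cr Cp Cd Bd κ lam : ℝ) (H : ℕ) :
    ℕ → ℕ → S → ℝ × ℝ × ℝ
  | 0, _, _ => (0, 0, 0)
  | n + 1, h, s =>
    let Qd : A → ℝ := fun a => Bd * β h s a +
      min (max (Cd * β h s a +
        Phat h (fun s' => (ClipTripleAux Phat r u β Cr Cp Cd Bd κ lam H n (h + 1) s').1) s a) 0)
        (Bd * ((H : ℝ) - h))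
    let Qr : A → ℝ := fun a => r h s a +
      min (max (Cr * β h s a +
        Phat h (fun s' => (ClipTripleAux Phat r u β Cr Cp Cd Bd κ lam H n (h + 1) s').2.1) s a) 0)
        (((H : ℝ) - h) * (1 + κ * Real.log (Fintype.card A)))
    let Qu : A → ℝ := fun a => u h s a +
      min (max (-(Cp * β h s a) +
        Phat h (fun s' => (ClipTripleAux Phat r u β Cr Cp Cd Bd κ lam H n (h + 1) s').2.2) s a) 0)
        ((H : ℝ) - h)
    let pol : A → ℝ := fun a =>
      Real.exp ((Qd a + Qr a + lam * Qu a) / κ)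
        / ∑ a', Real.exp ((Qd a' + Qr a' + lam * Qu a') / κ)
    (∑ a, pol a * Qd a,
     ∑ a, pol a * (Qr a - κ * Real.log (pol a)),
     ∑ a, pol a * Qu a)

/-- Clipped value-function triple `(V̄^{π^λ,†}_h, V̄^{π^λ,r}_h[κ], V̲^{π^λ,u}_h)` of the composite
softmax policy with parameter `λ`, at step `h` of a horizon-`H` MDP. -/
noncomputable def ClipTripleV {S A : Type*} [Fintype S] [Fintype A]
    (Phat : ℕ → (S → ℝ) → S → A → ℝ) (r u β : ℕ → S → A → ℝ)
    (Cr Cp Cd Bd κ lam : ℝ) (H : ℕ) (h : ℕ) (s : S) : ℝ × ℝ × ℝ :=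
  ClipTripleAux Phat r u β Cr Cp Cd Bd κ lam H (H + 1 - h) h s

section Softmax

variable {A : Type*} [Fintype A]

/-- The softmax distribution. -/
noncomputable def softmax (x : A → ℝ) (a : A) : ℝ :=
  Real.exp (x a) / ∑ a', Real.exp (x a')

/-- The expectation of `c` under `softmax x`, plus `κ` times the entropy of `softmax x`. -/
noncomputable def softmaxValue (κ : ℝ) (c x : A → ℝ) : ℝ :=
  ∑ a, softmax x a * (c a - κ * Real.log (softmax x a))

variable [Nonempty A]

theorem sum_exp_pos (x : A → ℝ) : 0 < ∑ a, Real.exp (x a) :=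
  Finset.sum_pos (fun _ _ => Real.exp_pos _) Finset.univ_nonempty

theorem softmax_pos (x : A → ℝ) (a : A) : 0 < softmax x a :=
  div_pos (Real.exp_pos _) (sum_exp_pos x)

theorem sum_softmax (x : A → ℝ) : ∑ a, softmax x a = 1 := by
  simp only [softmax, ← Finset.sum_div]
  exact div_self (sum_exp_pos x).ne'

theorem softmax_le_one (x : A → ℝ) (a : A) : softmax x a ≤ 1 := by
  rw [← sum_softmax x]
  exact Finset.single_le_sum (fun b _ => (softmax_pos x b).le) (Finset.mem_univ a)

theorem log_softmax (x : A → ℝ) (a : A) :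
    Real.log (softmax x a) = x a - Real.log (∑ a', Real.exp (x a')) := by
  rw [softmax, Real.log_div (Real.exp_pos _).ne' (sum_exp_pos x).ne', Real.log_exp]

theorem entropy_softmax_le (x : A → ℝ) :
    ∑ a, softmax x a * (-Real.log (softmax x a)) ≤ Real.log (Fintype.card A) := by
  have hn : (0 : ℝ) < Fintype.card A := by exact_mod_cast Fintype.card_pos
  have key : ∀ a, softmax x a * (-Real.log (softmax x a)) ≤
      softmax x a * Real.log (Fintype.card A) + ((Fintype.card A : ℝ)⁻¹ - softmax x a) := by
    intro a
    have hp := softmax_pos x a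
    have h1 := Real.log_le_sub_one_of_pos (inv_pos.2 (mul_pos hn hp))
    rw [Real.log_inv, Real.log_mul hn.ne' hp.ne'] at h1
    have h2 := mul_le_mul_of_nonneg_left h1 hp.le
    have h3 : softmax x a * (((Fintype.card A : ℝ) * softmax x a)⁻¹ - 1)
        = (Fintype.card A : ℝ)⁻¹ - softmax x a := by
      field_simp
    linarith
  refine (Finset.sum_le_sum fun a _ => key a).trans ?_
  rw [Finset.sum_add_distrib, Finset.sum_sub_distrib, ← Finset.sum_mul, sum_softmax]
  simp [hn.ne']

theorem hasDerivAt_log_sum_exp (x v : A → ℝ) (t : ℝ) :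
    HasDerivAt (fun t => Real.log (∑ a, Real.exp (x a + t * v a)))
      (∑ a, softmax (fun a => x a + t * v a) a * v a) t := by
  have h1 : HasDerivAt (fun t => ∑ a, Real.exp (x a + t * v a))
      (∑ a, Real.exp (x a + t * v a) * v a) t := by
    refine HasDerivAt.fun_sum fun a _ => ?_
    have := (((hasDerivAt_id t).mul_const (v a)).const_add (x a)).exp
    simpa using this
  convert h1.log (sum_exp_pos fun a => x a + t * v a).ne' using 1
  simp only [softmax, Finset.sum_div]
  exact Finset.sum_congr rfl fun a _ => by ring

theorem hasDerivAt_softmaxValue (κ : ℝ) (c x v : A → ℝ) (t : ℝ) :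
    HasDerivAt (fun t => softmaxValue κ c fun a => x a + t * v a)
      (∑ a, softmax (fun a => x a + t * v a) a *
        (v a - ∑ b, softmax (fun a => x a + t * v a) b * v b) *
        (c a - κ * Real.log (softmax (fun a => x a + t * v a) a))) t := by
  set m := ∑ b, softmax (fun a => x a + t * v a) b * v b with hm
  have hlog : ∀ a, HasDerivAt (fun t => Real.log (softmax (fun a => x a + t * v a) a))
      (v a - m) t := by
    intro a
    simp only [log_softmax]
    have := ((hasDerivAt_id t).mul_const (v a)).const_add (x a)
    refine (this.fun_sub (hasDerivAt_log_sum_exp x v t)).congr_deriv ?_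
    rw [one_mul]
  have hsoft : ∀ a, HasDerivAt (fun t => softmax (fun a => x a + t * v a) a)
      (softmax (fun a => x a + t * v a) a * (v a - m)) t := by
    intro a
    have := (hlog a).exp
    simpa only [Real.exp_log (softmax_pos _ _)] using this
  have hsum := HasDerivAt.fun_sum (u := Finset.univ) fun a _ =>
    (hsoft a).mul (((hlog a).const_mul κ).const_sub (c a))
  refine hsum.congr_deriv ?_
  have hzero : ∑ a, softmax (fun a => x a + t * v a) a * (κ * (v a - m)) = 0 := by
    have : ∀ a, softmax (fun a => x a + t * v a) a * (κ * (v a - m)) =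
        κ * (softmax (fun a => x a + t * v a) a * v a)
          - κ * m * softmax (fun a => x a + t * v a) a := fun a => by ring
    simp only [this, Finset.sum_sub_distrib, ← Finset.mul_sum, sum_softmax, ← hm]
    ring
  rw [← sub_eq_zero, ← Finset.sum_sub_distrib, ← neg_eq_zero, ← hzero, ← Finset.sum_neg_distrib]
  exact Finset.sum_congr rfl fun a _ => by ring

/-- The entropy-regularized value is Lipschitz in the logits. -/
theorem abs_softmaxValue_sub_le {κ K δ : ℝ} (hκ : 0 ≤ κ) {c x y : A → ℝ}
    (hc : ∀ a, c a ∈ Set.Icc 0 K) (hxy : ∀ a, |x a - y a| ≤ δ) :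
    |softmaxValue κ c x - softmaxValue κ c y| ≤
      2 * δ * (K + κ * Real.log (Fintype.card A)) := by
  have hδ : 0 ≤ δ := (abs_nonneg _).trans (hxy (Classical.arbitrary A))
  have hbound : ∀ t ∈ (Set.univ : Set ℝ),
      ‖∑ a, softmax (fun a => y a + t * (x a - y a)) a *
        ((x a - y a) - ∑ b, softmax (fun a => y a + t * (x a - y a)) b * (x b - y b)) *
        (c a - κ * Real.log (softmax (fun a => y a + t * (x a - y a)) a))‖ ≤
      2 * δ * (K + κ * Real.log (Fintype.card A)) := by
    intro t _
    set z : A → ℝ := fun a => y a + t * (x a - y a)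
    have hmean : |∑ b, softmax z b * (x b - y b)| ≤ δ := by
      refine (Finset.abs_sum_le_sum_abs _ _).trans ?_
      calc ∑ b, |softmax z b * (x b - y b)| ≤ ∑ b, softmax z b * δ := by
            refine Finset.sum_le_sum fun b _ => ?_
            rw [abs_mul, abs_of_pos (softmax_pos z b)]
            exact mul_le_mul_of_nonneg_left (hxy b) (softmax_pos z b).le
        _ = δ := by rw [← Finset.sum_mul, sum_softmax, one_mul]
    rw [Real.norm_eq_abs]
    refine (Finset.abs_sum_le_sum_abs _ _).trans ?_
    calc _ ≤ ∑ a, 2 * δ * (softmax z a * K + κ * (softmax z a * (-Real.log (softmax z a)))) := by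
          refine Finset.sum_le_sum fun a _ => ?_
          have hp := softmax_pos z a
          have hl : Real.log (softmax z a) ≤ 0 := Real.log_nonpos hp.le (softmax_le_one z a)
          have hκl : 0 ≤ κ * -Real.log (softmax z a) := mul_nonneg hκ (by linarith)
          have h1 : |(x a - y a) - ∑ b, softmax z b * (x b - y b)| ≤ 2 * δ :=
            (abs_sub _ _).trans (by linarith [hxy a])
          have h2 : |c a - κ * Real.log (softmax z a)| ≤ K + κ * -Real.log (softmax z a) := by
            rw [abs_of_nonneg (by linarith [(hc a).1])]
            linarith [(hc a).2]
          rw [abs_mul, abs_mul, abs_of_pos hp]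
          calc _ ≤ softmax z a * (2 * δ) * (K + κ * -Real.log (softmax z a)) := by gcongr
            _ = _ := by ring
      _ = 2 * δ * (K + κ * ∑ a, softmax z a * (-Real.log (softmax z a))) := by
          rw [← Finset.mul_sum, Finset.sum_add_distrib, ← Finset.sum_mul, sum_softmax, one_mul,
            ← Finset.mul_sum]
      _ ≤ _ := by gcongr; exact entropy_softmax_le z
  have := convex_univ.norm_image_sub_le_of_norm_hasDerivWithin_le
    (fun t _ => (hasDerivAt_softmaxValue κ c y (fun a => x a - y a) t).hasDerivWithinAt)
    hbound (Set.mem_univ 0) (Set.mem_univ 1)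
  simpa using this

/-- Perturbing both the payoff and the logits. -/
theorem abs_softmaxValue_sub_softmaxValue_le {κ K q δ : ℝ} (hκ : 0 ≤ κ) {c c' x y : A → ℝ}
    (hc : ∀ a, c' a ∈ Set.Icc 0 K) (hcc : ∀ a, |c a - c' a| ≤ q)
    (hxy : ∀ a, |x a - y a| ≤ δ) :
    |softmaxValue κ c x - softmaxValue κ c' y| ≤
      q + 2 * δ * (K + κ * Real.log (Fintype.card A)) := by
  have h1 : |softmaxValue κ c x - softmaxValue κ c' x| ≤ q := by
    have : softmaxValue κ c x - softmaxValue κ c' x = ∑ a, softmax x a * (c a - c' a) := by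
      rw [softmaxValue, softmaxValue, ← Finset.sum_sub_distrib]
      exact Finset.sum_congr rfl fun a _ => by ring
    rw [this]
    refine (Finset.abs_sum_le_sum_abs _ _).trans ?_
    calc ∑ a, |softmax x a * (c a - c' a)| ≤ ∑ a, softmax x a * q := by
          refine Finset.sum_le_sum fun a _ => ?_
          rw [abs_mul, abs_of_pos (softmax_pos x a)]
          exact mul_le_mul_of_nonneg_left (hcc a) (softmax_pos x a).le
      _ = q := by rw [← Finset.sum_mul, sum_softmax, one_mul]
  exact (abs_sub_le _ _ _).trans (add_le_add h1 (abs_softmaxValue_sub_le hκ hc hxy))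

end Softmax

theorem abs_clip_sub_clip_le (a b l m : ℝ) :
    |min (max a l) m - min (max b l) m| ≤ |a - b| := by
  refine (abs_min_sub_min_le_max _ _ _ _).trans (max_le ?_ (by simp))
  exact (abs_max_sub_max_le_max _ _ _ _).trans (by simp)

section Backup

variable {S A : Type*}

/-- The clipped Bellman backup `g + clip{b + P V, 0, m}`. -/
noncomputable def clippedBackup (P : (S → ℝ) → S → A → ℝ) (g b : S → A → ℝ) (m : ℝ)
    (V : S → ℝ) (s : S) (a : A) : ℝ :=
  g s a + min (max (b s a + P V s a) 0) m

theorem clippedBackup_mem_Icc {P : (S → ℝ) → S → A → ℝ} {g b : S → A → ℝ} {m K : ℝ}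
    (hm : 0 ≤ m) {s : S} {a : A} (hg : g s a ∈ Set.Icc 0 K) (V : S → ℝ) :
    clippedBackup P g b m V s a ∈ Set.Icc 0 (K + m) :=
  ⟨add_nonneg hg.1 (le_min (le_max_right _ _) hm), add_le_add hg.2 (min_le_right _ _)⟩

theorem abs_clippedBackup_sub_le [Fintype S] [Nonempty S] {P : (S → ℝ) → S → A → ℝ}
    (hP : IsLinearMap ℝ P) {M : ℝ} (hM : 0 ≤ M)
    (hbdd : ∀ V s a, |P V s a| ≤ M * (Finset.univ.sup' Finset.univ_nonempty fun s' => |V s'|))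
    (g b : S → A → ℝ) (m : ℝ) {V W : S → ℝ} {d : ℝ} (hd : ∀ s, |V s - W s| ≤ d) (s : S) (a : A) :
    |clippedBackup P g b m V s a - clippedBackup P g b m W s a| ≤ M * d := by
  rw [clippedBackup, clippedBackup, add_sub_add_left_eq_sub]
  refine (abs_clip_sub_clip_le _ _ _ _).trans ?_
  have hVW : P V s a - P W s a = P (V - W) s a := by rw [hP.map_sub]; rfl
  rw [add_sub_add_left_eq_sub, hVW]
  exact (hbdd _ s a).trans
    (mul_le_mul_of_nonneg_left (Finset.sup'_le _ _ fun s' _ => hd s') hM)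

end Backup

section Recursion

variable {S A : Type*} [Fintype S] [Fintype A]

theorem ClipTripleAux_succ (Phat : ℕ → (S → ℝ) → S → A → ℝ) (r u β : ℕ → S → A → ℝ)
    (Cr Cp Cd Bd κ lam : ℝ) (H n h : ℕ) (s : S) :
    ClipTripleAux Phat r u β Cr Cp Cd Bd κ lam H (n + 1) h s =
      let T := ClipTripleAux Phat r u β Cr Cp Cd Bd κ lam H n (h + 1)
      let Qd := clippedBackup (Phat h) (fun s a => Bd * β h s a) (fun s a => Cd * β h s a)
        (Bd * ((H : ℝ) - h)) (fun s' => (T s').1) s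
      let Qr := clippedBackup (Phat h) (r h) (fun s a => Cr * β h s a)
        (((H : ℝ) - h) * (1 + κ * Real.log (Fintype.card A))) (fun s' => (T s').2.1) s
      let Qu := clippedBackup (Phat h) (u h) (fun s a => -(Cp * β h s a))
        ((H : ℝ) - h) (fun s' => (T s').2.2) s
      let x := fun a => (Qd a + Qr a + lam * Qu a) / κ
      (softmaxValue 0 Qd x, softmaxValue κ Qr x, softmaxValue 0 Qu x) := by
  simp only [softmaxValue, zero_mul, sub_zero]
  rfl

variable [Nonempty S] [Nonempty A]

/-- One backward step: if the three values at step `h + 1` move by at most `dd`, `dr`, `du`, the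
values at step `h` move by at most `M` times that plus the effect of the change of policy. -/
theorem ClipTripleAux_step {Phat : ℕ → (S → ℝ) → S → A → ℝ} (hlin : ∀ h, IsLinearMap ℝ (Phat h))
    {M : ℝ} (hM : 0 ≤ M)
    (hbdd : ∀ h (V : S → ℝ) s a,
      |Phat h V s a| ≤ M * (Finset.univ.sup' Finset.univ_nonempty fun s' => |V s'|))
    {Cr Cp Cd Bd Clam κ : ℝ} (hBd : 0 ≤ Bd) (hκ : 0 < κ) {r u β : ℕ → S → A → ℝ}
    (hr : ∀ h s a, r h s a ∈ Set.Icc (0 : ℝ) 1) (hu : ∀ h s a, u h s a ∈ Set.Icc (0 : ℝ) 1)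
    (hβ : ∀ h s a, β h s a ∈ Set.Icc (0 : ℝ) 1)
    {lam ε : ℝ} (hlam : 0 ≤ lam) (hε : 0 ≤ ε) (hle : lam + ε ≤ Clam)
    {H n h : ℕ} (hh : 1 ≤ h) (hhH : h ≤ H) {dd dr du : ℝ}
    (hd : ∀ s, |(ClipTripleAux Phat r u β Cr Cp Cd Bd κ lam H n (h + 1) s).1 -
      (ClipTripleAux Phat r u β Cr Cp Cd Bd κ (lam + ε) H n (h + 1) s).1| ≤ dd)
    (hr' : ∀ s, |(ClipTripleAux Phat r u β Cr Cp Cd Bd κ lam H n (h + 1) s).2.1 -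
      (ClipTripleAux Phat r u β Cr Cp Cd Bd κ (lam + ε) H n (h + 1) s).2.1| ≤ dr)
    (hu' : ∀ s, |(ClipTripleAux Phat r u β Cr Cp Cd Bd κ lam H n (h + 1) s).2.2 -
      (ClipTripleAux Phat r u β Cr Cp Cd Bd κ (lam + ε) H n (h + 1) s).2.2| ≤ du)
    {δ : ℝ} (hδ : δ = ((1 + Clam) * (M * (dd + dr + du)) + ε * H) / κ) (s : S) :
    |(ClipTripleAux Phat r u β Cr Cp Cd Bd κ lam H (n + 1) h s).1 -
      (ClipTripleAux Phat r u β Cr Cp Cd Bd κ (lam + ε) H (n + 1) h s).1|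
        ≤ M * dd + 2 * δ * (Bd * H) ∧
    |(ClipTripleAux Phat r u β Cr Cp Cd Bd κ lam H (n + 1) h s).2.1 -
      (ClipTripleAux Phat r u β Cr Cp Cd Bd κ (lam + ε) H (n + 1) h s).2.1|
        ≤ M * dr + 2 * δ * (H * (1 + κ * Real.log (Fintype.card A))) ∧
    |(ClipTripleAux Phat r u β Cr Cp Cd Bd κ lam H (n + 1) h s).2.2 -
      (ClipTripleAux Phat r u β Cr Cp Cd Bd κ (lam + ε) H (n + 1) h s).2.2|
        ≤ M * du + 2 * δ * H := by
  rw [ClipTripleAux_succ, ClipTripleAux_succ]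
  set T := ClipTripleAux Phat r u β Cr Cp Cd Bd κ lam H n (h + 1)
  set T' := ClipTripleAux Phat r u β Cr Cp Cd Bd κ (lam + ε) H n (h + 1)
  have hh1 : (1 : ℝ) ≤ h := by exact_mod_cast hh
  have hHh : (0 : ℝ) ≤ (H : ℝ) - h := by
    have : (h : ℝ) ≤ H := by exact_mod_cast hhH
    linarith
  have hlog : 0 ≤ Real.log (Fintype.card A) := Real.log_natCast_nonneg _
  have hκlog := mul_nonneg hκ.le hlog
  have hdd := (abs_nonneg _).trans (hd (Classical.arbitrary S))
  have hdr := (abs_nonneg _).trans (hr' (Classical.arbitrary S))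
  have hdu := (abs_nonneg _).trans (hu' (Classical.arbitrary S))
  have hQd := abs_clippedBackup_sub_le (hlin h) hM (hbdd h) (fun s a => Bd * β h s a)
    (fun s a => Cd * β h s a) (Bd * ((H : ℝ) - h)) hd s
  have hQr := abs_clippedBackup_sub_le (hlin h) hM (hbdd h) (r h)
    (fun s a => Cr * β h s a) (((H : ℝ) - h) * (1 + κ * Real.log (Fintype.card A))) hr' s
  have hQu := abs_clippedBackup_sub_le (hlin h) hM (hbdd h) (u h)
    (fun s a => -(Cp * β h s a)) ((H : ℝ) - h) hu' s
  have hBdβ : ∀ a, Bd * β h s a ∈ Set.Icc 0 Bd := fun a =>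
    ⟨mul_nonneg hBd (hβ h s a).1, mul_le_of_le_one_right hBd (hβ h s a).2⟩
  have hId := fun a => clippedBackup_mem_Icc (P := Phat h) (g := fun s a => Bd * β h s a)
    (b := fun s a => Cd * β h s a) (mul_nonneg hBd hHh) (hBdβ a) fun s' => (T' s').1
  have hIr := fun a => clippedBackup_mem_Icc (P := Phat h) (b := fun s a => Cr * β h s a)
    (mul_nonneg hHh (add_nonneg zero_le_one hκlog)) (hr h s a) fun s' => (T' s').2.1
  have hIu := fun a => clippedBackup_mem_Icc (P := Phat h) (b := fun s a => -(Cp * β h s a))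
    hHh (hu h s a) fun s' => (T' s').2.2
  dsimp only
  set Qd := clippedBackup (Phat h) (fun s a => Bd * β h s a) (fun s a => Cd * β h s a)
    (Bd * ((H : ℝ) - h)) (fun s' => (T s').1) s
  set Qd' := clippedBackup (Phat h) (fun s a => Bd * β h s a) (fun s a => Cd * β h s a)
    (Bd * ((H : ℝ) - h)) (fun s' => (T' s').1) s
  set Qr := clippedBackup (Phat h) (r h) (fun s a => Cr * β h s a)
    (((H : ℝ) - h) * (1 + κ * Real.log (Fintype.card A))) (fun s' => (T s').2.1) s
  set Qr' := clippedBackup (Phat h) (r h) (fun s a => Cr * β h s a)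
    (((H : ℝ) - h) * (1 + κ * Real.log (Fintype.card A))) (fun s' => (T' s').2.1) s
  set Qu := clippedBackup (Phat h) (u h) (fun s a => -(Cp * β h s a))
    ((H : ℝ) - h) (fun s' => (T s').2.2) s
  set Qu' := clippedBackup (Phat h) (u h) (fun s a => -(Cp * β h s a))
    ((H : ℝ) - h) (fun s' => (T' s').2.2) s
  have hδ0 : 0 ≤ δ := by
    have : 0 ≤ Clam := by linarith
    rw [hδ]
    positivity
  have hx : ∀ a, |(Qd a + Qr a + lam * Qu a) / κ - (Qd' a + Qr' a + (lam + ε) * Qu' a) / κ|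
      ≤ δ := by
    intro a
    rw [← sub_div, abs_div, abs_of_pos hκ, hδ]
    gcongr
    have e : Qd a + Qr a + lam * Qu a - (Qd' a + Qr' a + (lam + ε) * Qu' a) =
        (Qd a - Qd' a) + (Qr a - Qr' a) + lam * (Qu a - Qu' a) - ε * Qu' a := by ring
    have h1 : |lam * (Qu a - Qu' a)| ≤ Clam * (M * du) := by
      rw [abs_mul, abs_of_nonneg hlam]
      exact mul_le_mul (by linarith) (hQu a) (abs_nonneg _) (by linarith)
    have h2 : |ε * Qu' a| ≤ ε * H := by
      rw [abs_mul, abs_of_nonneg hε, abs_of_nonneg (hIu a).1]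
      exact mul_le_mul_of_nonneg_left ((hIu a).2.trans (by linarith)) hε
    have h3 : 0 ≤ Clam * (M * dd) + Clam * (M * dr) + M * du := by
      have : 0 ≤ Clam := by linarith
      positivity
    have h4 := abs_sub ((Qd a - Qd' a) + (Qr a - Qr' a) + lam * (Qu a - Qu' a)) (ε * Qu' a)
    have h5 := abs_add_three (Qd a - Qd' a) (Qr a - Qr' a) (lam * (Qu a - Qu' a))
    rw [e]
    linarith [hQd a, hQr a]
  refine ⟨(abs_softmaxValue_sub_softmaxValue_le le_rfl hId hQd hx).trans ?_,
    (abs_softmaxValue_sub_softmaxValue_le hκ.le hIr hQr hx).trans ?_,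
    (abs_softmaxValue_sub_softmaxValue_le le_rfl hIu hQu hx).trans ?_⟩
  · gcongr
    nlinarith
  · gcongr
    nlinarith
  · gcongr
    linarith

end Recursion

/-- **Sensitivity of the pessimistic utility value to the Lagrange multiplier.**
If each `P̂_h` is linear and bounded (`|P̂_h V(s,a)| ≤ M·max_{s'}|V(s')|`), then with
`H_κ = H(1+κ·ln|A|)`, `X = M·(1 + 8(1+C_λ)(H_κ + B_†H + H)/κ)` and
`Y = 8(H_κ + B_†H + H)/κ`, for all `λ ≥ 0`, `ε ≥ 0` with `λ + ε ≤ C_λ`: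
`|V̲^{π^λ,u}_1(s₁) − V̲^{π^{λ+ε},u}_1(s₁)| ≤ (Σ_{j=0}^H X^j)·Y·H·ε`. -/
theorem lambda_sensitivity
    {S A : Type*} [Fintype S] [Fintype A] [Nonempty S] [Nonempty A]
    (H : ℕ) (hH : 1 ≤ H)
    (Phat : ℕ → (S → ℝ) → S → A → ℝ)
    (hlin : ∀ h, IsLinearMap ℝ (Phat h))
    (M : ℝ) (hM : 0 ≤ M)
    (hbdd : ∀ h (V : S → ℝ) s a,
      |Phat h V s a| ≤ M * (Finset.univ.sup' Finset.univ_nonempty fun s' => |V s'|))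
    (s₁ : S) (Cr Cp Cd Bd Clam κ : ℝ)
    (hCr : 0 < Cr) (hCp : 0 < Cp) (hCd : 0 < Cd) (hBd : 0 ≤ Bd)
    (hClam : 0 ≤ Clam) (hκ : 0 < κ)
    (r u β : ℕ → S → A → ℝ)
    (hr : ∀ h s a, r h s a ∈ Set.Icc (0:ℝ) 1)
    (hu : ∀ h s a, u h s a ∈ Set.Icc (0:ℝ) 1)
    (hβ : ∀ h s a, β h s a ∈ Set.Icc (0:ℝ) 1)
    (lam ε : ℝ) (hlam : 0 ≤ lam) (hε : 0 ≤ ε) (hle : lam + ε ≤ Clam) :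
    |(ClipTripleV Phat r u β Cr Cp Cd Bd κ lam H 1 s₁).2.2
        - (ClipTripleV Phat r u β Cr Cp Cd Bd κ (lam + ε) H 1 s₁).2.2|
      ≤ (∑ j ∈ Finset.range (H + 1),
            (M * (1 + 8 * (1 + Clam)
              * (H * (1 + κ * Real.log (Fintype.card A)) + Bd * H + H) / κ)) ^ j)
          * (8 * (H * (1 + κ * Real.log (Fintype.card A)) + Bd * H + H) / κ) * H * ε := by
  have hlog : 0 ≤ κ * Real.log (Fintype.card A) :=
    mul_nonneg hκ.le (Real.log_natCast_nonneg _)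
  set N : ℝ := H * (1 + κ * Real.log (Fintype.card A)) + Bd * H + H with hN
  have hN0 : 0 ≤ N := by positivity
  set X : ℝ := M * (1 + 8 * (1 + Clam) * N / κ) with hX
  have hX0 : 0 ≤ X := by positivity
  have hY0 : 0 ≤ 8 * N / κ * H * ε := by positivity
  have key : ∀ n h : ℕ, 1 ≤ h → n + h = H + 1 → ∃ dd dr du : ℝ,
      (∀ s, |(ClipTripleAux Phat r u β Cr Cp Cd Bd κ lam H n h s).1 -
        (ClipTripleAux Phat r u β Cr Cp Cd Bd κ (lam + ε) H n h s).1| ≤ dd) ∧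
      (∀ s, |(ClipTripleAux Phat r u β Cr Cp Cd Bd κ lam H n h s).2.1 -
        (ClipTripleAux Phat r u β Cr Cp Cd Bd κ (lam + ε) H n h s).2.1| ≤ dr) ∧
      (∀ s, |(ClipTripleAux Phat r u β Cr Cp Cd Bd κ lam H n h s).2.2 -
        (ClipTripleAux Phat r u β Cr Cp Cd Bd κ (lam + ε) H n h s).2.2| ≤ du) ∧
      dd + dr + du ≤ (∑ j ∈ Finset.range n, X ^ j) * (8 * N / κ * H * ε) := by
    intro n
    induction n with
    | zero =>
      intro h _ _
      exact ⟨0, 0, 0, by simp [ClipTripleAux], by simp [ClipTripleAux],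
        by simp [ClipTripleAux], by simp⟩
    | succ n ih =>
      intro h h1 hnh
      obtain ⟨dd, dr, du, hd, hr', hu', hsum⟩ := ih (h + 1) (by omega) (by omega)
      have hdd := (abs_nonneg _).trans (hd s₁)
      have hdr := (abs_nonneg _).trans (hr' s₁)
      have hdu := (abs_nonneg _).trans (hu' s₁)
      have step := ClipTripleAux_step hlin hM hbdd hBd hκ hr hu hβ hlam hε hle h1 (by omega)
        hd hr' hu' rfl
      refine ⟨_, _, _, fun s => (step s).1, fun s => (step s).2.1, fun s => (step s).2.2, ?_⟩
      set D := dd + dr + du with hD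
      have hD0 : 0 ≤ D := by positivity
      have hδ0 : 0 ≤ ((1 + Clam) * (M * D) + ε * H) / κ := by positivity
      calc _ = M * D + 2 * (((1 + Clam) * (M * D) + ε * H) / κ) * N := by rw [hN, hD]; ring
        _ ≤ M * D + 8 * (((1 + Clam) * (M * D) + ε * H) / κ) * N := by gcongr; norm_num
        _ = X * D + 8 * N / κ * H * ε := by rw [hX]; ring
        _ ≤ X * ((∑ j ∈ Finset.range n, X ^ j) * (8 * N / κ * H * ε))
            + 8 * N / κ * H * ε := by gcongr
        _ = _ := by rw [geom_sum_succ]; ring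
  obtain ⟨dd, dr, du, hd, hr', hu', hsum⟩ := key H 1 le_rfl rfl
  have hdd := (abs_nonneg _).trans (hd s₁)
  have hdr := (abs_nonneg _).trans (hr' s₁)
  calc _ ≤ du := hu' s₁
    _ ≤ dd + dr + du := by linarith
    _ ≤ (∑ j ∈ Finset.range H, X ^ j) * (8 * N / κ * H * ε) := hsum
    _ ≤ (∑ j ∈ Finset.range (H + 1), X ^ j) * (8 * N / κ * H * ε) := by
      gcongr
      exact H.le_succ
    _ = _ := by ring
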